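/- Let p₁, q₁, p₂, q₂ be unit quaternions, and consider the great 3-spheres Σ₁ = {(x, p₁ x q₁⁻¹)} and Σ₂ = {(y, p₂ y q₂⁻¹)} in S³ × S³. The function sending a unit quaternion z to the distance from (z, p₁ z q₁⁻¹) to Σ₂, namely z ↦ inf over unit y of √(dS(z, y)² + dS(p₁ z q₁⁻¹, p₂ y q₂⁻¹)²), is constant (i.e., Σ₁ and Σ₂ are parallel) if and only if p₁ = p₂ or p₁ = −p₂ or q₁ = q₂ or q₁ = −q₂. -/

import Mathlib

open Quaternion

/-- Geodesic distance on the unit 3-sphere of quaternions: `dS(a,b) = arccos ⟪a, b⟫` where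
`⟪a, b⟫ = re(a * star b)`. -/
noncomputable def dS (a b : ℍ[ℝ]) : ℝ := Real.arccos (a * star b).re

/-- Distance in the product metric from the point `(z, p₁ z q₁⁻¹)` of
`Σ₁ = {(x, p₁ x q₁⁻¹)}` to the great 3-sphere `Σ₂ = {(y, p₂ y q₂⁻¹)}`. -/
noncomputable def distToSigma (p₁ q₁ p₂ q₂ z : ℍ[ℝ]) : ℝ :=
  sInf {v : ℝ | ∃ y : ℍ[ℝ], ‖y‖ = 1 ∧
    v = Real.sqrt (dS z y ^ 2 + dS (p₁ * z * q₁⁻¹) (p₂ * y * q₂⁻¹) ^ 2)}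


lemma aux_inner (a b : ℍ[ℝ]) : (a * star b).re = inner ℝ a b := by
  rw [Quaternion.inner_def]

lemma aux_dS_angle (a b : ℍ[ℝ]) (ha : ‖a‖ = 1) (hb : ‖b‖ = 1) :
    dS a b = InnerProductGeometry.angle a b := by
  unfold dS InnerProductGeometry.angle
  rw [aux_inner, ha, hb]; simp

lemma aux_inv (q : ℍ[ℝ]) (hq : ‖q‖ = 1) : q⁻¹ = star q := by
  rw [Quaternion.inv_def, Quaternion.normSq_eq_norm_mul_self, hq]; simp

lemma aux_star_mul (q : ℍ[ℝ]) (hq : ‖q‖ = 1) : star q * q = 1 := by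
  rw [← aux_inv q hq]
  exact inv_mul_cancel₀ (by rintro rfl; simp at hq)

lemma aux_mul_star (q : ℍ[ℝ]) (hq : ‖q‖ = 1) : q * star q = 1 := by
  rw [← aux_inv q hq]
  exact mul_inv_cancel₀ (by rintro rfl; simp at hq)

lemma aux_re_comm (a b : ℍ[ℝ]) : (a * b).re = (b * a).re := by
  simp only [Quaternion.re_mul]; ring

lemma aux_norm (z : ℍ[ℝ]) : ‖z‖ = 1 ↔ z.re^2+z.imI^2+z.imJ^2+z.imK^2 = 1 := by
  rw [← Quaternion.normSq_def', Quaternion.normSq_eq_norm_mul_self]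
  constructor
  · intro h; rw [h]; norm_num
  · intro h; nlinarith [norm_nonneg z]

noncomputable def mkQ (a b c d : ℝ) : ℍ[ℝ] := ⟨a, b, c, d⟩
lemma mkQ_re (a b c d : ℝ) : (mkQ a b c d).re = a := rfl
lemma mkQ_imI (a b c d : ℝ) : (mkQ a b c d).imI = b := rfl
lemma mkQ_imJ (a b c d : ℝ) : (mkQ a b c d).imJ = c := rfl
lemma mkQ_imK (a b c d : ℝ) : (mkQ a b c d).imK = d := rfl

lemma mkQ_norm (a b c d : ℝ) (h : a^2+b^2+c^2+d^2 = 1) : ‖mkQ a b c d‖ = 1 :=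
  (aux_norm _).2 h

lemma aux_mid (z w : ℍ[ℝ]) (hz : ‖z‖ = 1) (hw : ‖w‖ = 1) :
    ∃ y : ℍ[ℝ], ‖y‖ = 1 ∧ dS z y = dS z w / 2 ∧ dS w y = dS z w / 2 := by
  have hin : Real.cos (dS z w) = inner ℝ z w := by
    rw [aux_dS_angle z w hz hw, InnerProductGeometry.cos_angle, hz, hw]; simp
  have h0 : 0 ≤ dS z w := Real.arccos_nonneg _
  have hpi : dS z w ≤ Real.pi := Real.arccos_le_pi _
  set θ := dS z w with hθ
  have hcos2 : Real.cos θ = 2 * Real.cos (θ/2) ^ 2 - 1 := by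
    rw [← Real.cos_two_mul]; congr 1; ring
  have hzz : inner ℝ z z = (1:ℝ) := by rw [real_inner_self_eq_norm_sq, hz]; simp
  have hww : inner ℝ w w = (1:ℝ) := by rw [real_inner_self_eq_norm_sq, hw]; simp
  have hwz : inner ℝ w z = Real.cos θ := by rw [real_inner_comm, hin]
  have fin : ∀ x y : ℍ[ℝ], inner ℝ x y = Real.cos (θ/2) → dS x y = θ/2 := by
    intro x y h
    unfold dS
    rw [aux_inner, h, Real.arccos_cos (by linarith) (by linarith)]
  rcases eq_or_lt_of_le hpi with h | h
  · have hc0 : Real.cos (θ/2) = 0 := by rw [h, Real.cos_pi_div_two]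
    have hwe : w = -z := by
      have : ‖z + w‖ ^ 2 = 0 := by
        rw [norm_add_sq_real, hz, hw, ← hin, hcos2, hc0]; norm_num
      have : z + w = 0 := by simpa using this
      exact (neg_eq_of_add_eq_zero_right this).symm
    have hI : ‖mkQ 0 1 0 0‖ = 1 := mkQ_norm _ _ _ _ (by norm_num)
    have hort : inner ℝ z (z * (mkQ (0) (1) (0) (0))) = (0:ℝ) := by
      rw [← aux_inner]
      simp [Quaternion.re_mul, Quaternion.imI_mul, Quaternion.imJ_mul, Quaternion.imK_mul, mkQ_re, mkQ_imI, mkQ_imJ, mkQ_imK]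
      ring
    refine ⟨z * (mkQ (0) (1) (0) (0)), by rw [norm_mul, hz, hI, one_mul], fin _ _ ?_, fin _ _ ?_⟩
    · rw [hort, hc0]
    · rw [hwe, inner_neg_left, hort, hc0, neg_zero]
  · have hc : 0 < Real.cos (θ/2) := Real.cos_pos_of_mem_Ioo ⟨by linarith, by linarith⟩
    set c := Real.cos (θ/2) with hcdef
    have hn : ‖z + w‖ = 2 * c := by
      have : ‖z + w‖ ^ 2 = (2 * c) ^ 2 := by
        rw [norm_add_sq_real, hz, hw, ← hin, hcos2]; ring
      exact (sq_eq_sq₀ (norm_nonneg _) (by positivity)).1 this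
    refine ⟨(2 * c)⁻¹ • (z + w), ?_, fin _ _ ?_, fin _ _ ?_⟩
    · rw [norm_smul, hn, Real.norm_of_nonneg (by positivity)]
      field_simp
    · rw [inner_smul_right, inner_add_right, hzz, ← hin, hcos2]; field_simp; ring
    · rw [inner_smul_right, inner_add_right, hww, hwz, hcos2]; field_simp; ring

lemma aux_dist (p₁ q₁ p₂ q₂ z : ℍ[ℝ])
    (hp₁ : ‖p₁‖ = 1) (hq₁ : ‖q₁‖ = 1) (hp₂ : ‖p₂‖ = 1) (hq₂ : ‖q₂‖ = 1) (hz : ‖z‖ = 1) :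
    distToSigma p₁ q₁ p₂ q₂ z =
      Real.sqrt (dS z ((star p₂ * p₁) * z * star (star q₂ * q₁)) ^ 2 / 2) := by
  set w := (star p₂ * p₁) * z * star (star q₂ * q₁) with hw
  have hwn : ‖w‖ = 1 := by simp [hw, hp₁, hp₂, hq₁, hq₂, hz]
  have key : ∀ y, dS (p₁ * z * q₁⁻¹) (p₂ * y * q₂⁻¹) = dS w y := by
    intro y
    unfold dS
    congr 1
    rw [aux_inv _ hq₁, aux_inv _ hq₂, hw]
    simp only [star_mul, star_star]
    rw [show p₁ * z * star q₁ * (q₂ * (star y * star p₂))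
      = (p₁ * z * star q₁ * q₂ * star y) * star p₂ by simp only [mul_assoc], aux_re_comm]
    simp only [mul_assoc]
  unfold distToSigma
  simp only [key]
  apply IsLeast.csInf_eq
  constructor
  · obtain ⟨y, hy, h1, h2⟩ := aux_mid z w hz hwn
    refine ⟨y, hy, ?_⟩
    rw [h1, h2]; congr 1; ring
  · rintro v ⟨y, hy, rfl⟩
    apply Real.sqrt_le_sqrt
    have tri : dS z w ≤ dS z y + dS w y := by
      rw [aux_dS_angle z w hz hwn, aux_dS_angle z y hz hy, aux_dS_angle w y hwn hy,
        InnerProductGeometry.angle_comm w y]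
      exact InnerProductGeometry.angle_le_angle_add_angle _ _ _
    have h0 : 0 ≤ dS z w := Real.arccos_nonneg _
    nlinarith [sq_nonneg (dS z y - dS w y)]

lemma aux_form (p q z : ℍ[ℝ]) : (z * star (p * z * star q)).re =
    p.re * q.re * (z.re^2+z.imI^2+z.imJ^2+z.imK^2)
    + p.imI * (q.imI * (z.re^2+z.imI^2-z.imJ^2-z.imK^2)
        + q.imJ * (2 * (z.imI*z.imJ - z.re*z.imK)) + q.imK * (2*(z.imI*z.imK + z.re*z.imJ)))
    + p.imJ * (q.imI * (2 * (z.imI*z.imJ + z.re*z.imK)) +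
        q.imJ * (z.re^2-z.imI^2+z.imJ^2-z.imK^2) + q.imK * (2*(z.imJ*z.imK - z.re*z.imI)))
    + p.imK * (q.imI * (2 * (z.imI*z.imK - z.re*z.imJ)) +
        q.imJ * (2*(z.imJ*z.imK + z.re*z.imI)) + q.imK * (z.re^2-z.imI^2-z.imJ^2+z.imK^2)) := by
  simp [Quaternion.re_mul, Quaternion.imI_mul, Quaternion.imJ_mul, Quaternion.imK_mul]
  ring

lemma aux_pm (p₁ p₂ : ℍ[ℝ]) (hp₁ : ‖p₁‖ = 1) (hp₂ : ‖p₂‖ = 1) :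
    (p₁ = p₂ ∨ p₁ = -p₂) ↔ ((star p₂ * p₁).imI = 0 ∧ (star p₂ * p₁).imJ = 0 ∧
      (star p₂ * p₁).imK = 0) := by
  constructor
  · rintro (rfl | rfl)
    · rw [aux_star_mul _ hp₁]; simp
    · rw [mul_neg, aux_star_mul _ hp₂]; simp
  · rintro ⟨h1, h2, h3⟩
    have hn : ‖star p₂ * p₁‖ = 1 := by simp [hp₁, hp₂]
    have hrec : p₁ = p₂ * (star p₂ * p₁) := by
      rw [← mul_assoc, aux_mul_star _ hp₂, one_mul]
    have := (aux_norm _).1 hn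
    rw [h1, h2, h3] at this
    have h4 : (star p₂ * p₁).re = 1 ∨ (star p₂ * p₁).re = -1 := by
      exact mul_self_eq_one_iff.1 (by linarith)
    rcases h4 with h4 | h4
    · left
      have : star p₂ * p₁ = 1 := by ext <;> simp only [h1, h2, h3, h4] <;> simp
      rw [hrec, this, mul_one]
    · right
      have : star p₂ * p₁ = -1 := by ext <;> simp only [h1, h2, h3, h4] <;> simp
      rw [hrec, this, mul_neg, mul_one]

theorem parallel_iff (p₁ q₁ p₂ q₂ : ℍ[ℝ])
    (hp₁ : ‖p₁‖ = 1) (hq₁ : ‖q₁‖ = 1) (hp₂ : ‖p₂‖ = 1) (hq₂ : ‖q₂‖ = 1) :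
    (∀ z w : ℍ[ℝ], ‖z‖ = 1 → ‖w‖ = 1 →
        distToSigma p₁ q₁ p₂ q₂ z = distToSigma p₁ q₁ p₂ q₂ w) ↔
      (p₁ = p₂ ∨ p₁ = -p₂ ∨ q₁ = q₂ ∨ q₁ = -q₂) := by
  rw [← or_assoc, aux_pm p₁ p₂ hp₁ hp₂, aux_pm q₁ q₂ hq₁ hq₂]
  have hd := fun z => aux_dist p₁ q₁ p₂ q₂ z hp₁ hq₁ hp₂ hq₂
  have hpn : ‖star p₂ * p₁‖ = 1 := by simp [hp₁, hp₂]
  have hqn : ‖star q₂ * q₁‖ = 1 := by simp [hq₁, hq₂]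
  generalize star p₂ * p₁ = p at *
  generalize star q₂ * q₁ = q at *
  constructor
  · intro H
    have G : ∀ z w : ℍ[ℝ], ‖z‖ = 1 → ‖w‖ = 1 →
        (z * star (p * z * star q)).re = (w * star (p * w * star q)).re := by
      intro z w hz hw
      have h := H z w hz hw
      rw [hd z hz, hd w hw, Real.sqrt_inj (by positivity) (by positivity)] at h
      have h0 : ∀ z, 0 ≤ dS z (p * z * star q) := fun z => Real.arccos_nonneg _
      have h' : dS z (p * z * star q) = dS w (p * w * star q) :=
        (sq_eq_sq₀ (h0 z) (h0 w)).1 (by linarith)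
      have hb : ∀ z : ℍ[ℝ], ‖z‖ = 1 → |(z * star (p * z * star q)).re| ≤ 1 := by
        intro z hz
        rw [aux_inner]
        refine (abs_real_inner_le_norm _ _).trans ?_
        simp [hz, hpn, hqn]
      exact Real.arccos_injOn (abs_le.1 (hb z hz)) (abs_le.1 (hb w hw)) h'
    have n1 : ‖((mkQ (1) (0) (0) (0)))‖ = 1 := mkQ_norm _ _ _ _ (by norm_num)
    have e1 := G (mkQ (1) (0) (0) (0)) (mkQ (0) (1) (0) (0)) n1 (mkQ_norm _ _ _ _ (by norm_num))
    have e2 := G (mkQ (1) (0) (0) (0)) (mkQ (0) (0) (1) (0)) n1 (mkQ_norm _ _ _ _ (by norm_num))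
    have e3 := G (mkQ (1) (0) (0) (0)) (mkQ (0) (0) (0) (1)) n1 (mkQ_norm _ _ _ _ (by norm_num))
    have e4 := G (mkQ (1) (0) (0) (0)) (mkQ (3/5) (4/5) (0) (0)) n1 (mkQ_norm _ _ _ _ (by norm_num))
    have e5 := G (mkQ (1) (0) (0) (0)) (mkQ (3/5) (0) (4/5) (0)) n1 (mkQ_norm _ _ _ _ (by norm_num))
    have e6 := G (mkQ (1) (0) (0) (0)) (mkQ (3/5) (0) (0) (4/5)) n1 (mkQ_norm _ _ _ _ (by norm_num))
    have e7 := G (mkQ (1) (0) (0) (0)) (mkQ (0) (3/5) (4/5) (0)) n1 (mkQ_norm _ _ _ _ (by norm_num))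
    have e8 := G (mkQ (1) (0) (0) (0)) (mkQ (0) (3/5) (0) (4/5)) n1 (mkQ_norm _ _ _ _ (by norm_num))
    have e9 := G (mkQ (1) (0) (0) (0)) (mkQ (0) (0) (3/5) (4/5)) n1 (mkQ_norm _ _ _ _ (by norm_num))
    simp only [aux_form, mkQ_re, mkQ_imI, mkQ_imJ, mkQ_imK] at e1 e2 e3 e4 e5 e6 e7 e8 e9
    clear G H hd
    have a11 : p.imI * q.imI = 0 := by linarith
    have a22 : p.imJ * q.imJ = 0 := by linarith
    have a33 : p.imK * q.imK = 0 := by linarith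
    have a12 : p.imI * q.imJ = 0 := by linarith
    have a21 : p.imJ * q.imI = 0 := by linarith
    have a13 : p.imI * q.imK = 0 := by linarith
    have a31 : p.imK * q.imI = 0 := by linarith
    have a23 : p.imJ * q.imK = 0 := by linarith
    have a32 : p.imK * q.imJ = 0 := by linarith
    clear e1 e2 e3 e4 e5 e6 e7 e8 e9
    by_cases h1 : p.imI = 0
    · by_cases h2 : p.imJ = 0
      · by_cases h3 : p.imK = 0
        · exact Or.inl ⟨h1, h2, h3⟩
        · exact Or.inr ⟨(mul_eq_zero.1 a31).resolve_left h3, (mul_eq_zero.1 a32).resolve_left h3,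
            (mul_eq_zero.1 a33).resolve_left h3⟩
      · exact Or.inr ⟨(mul_eq_zero.1 a21).resolve_left h2, (mul_eq_zero.1 a22).resolve_left h2,
          (mul_eq_zero.1 a23).resolve_left h2⟩
    · exact Or.inr ⟨(mul_eq_zero.1 a11).resolve_left h1, (mul_eq_zero.1 a12).resolve_left h1,
        (mul_eq_zero.1 a13).resolve_left h1⟩
  · intro h z w hz hw
    rw [hd z hz, hd w hw]
    have F : ∀ z : ℍ[ℝ], ‖z‖ = 1 → dS z (p * z * star q) = Real.arccos (p.re * q.re) := by
      intro z hz
      unfold dS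
      rw [aux_form, (aux_norm z).1 hz]
      rcases h with ⟨h1, h2, h3⟩ | ⟨h1, h2, h3⟩ <;> simp [h1, h2, h3]
    rw [F z hz, F w hw]
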